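/- arXiv:0706.3515 — 2 statements merged into one kernel-verified Lean document; each statement's English description precedes it below -/
import Mathlib

section
/- Let $K$ be a division ring and $a, b \in K$. The left $K[t]$-modules $K[t]/K[t](t-a)$ and $K[t]/K[t](t-b)$ are isomorphic if and only if $a$ and $b$ are conjugate in $K$. -/
open Polynomial

theorem Polynomial.C_eval_sub_mem_span_X_sub_C {R : Type*} [Ring R] (a : R) (p : R[X]) :
    p - C (p.eval a) ∈ (Submodule.span R[X] {X - C a} : Submodule R[X] R[X]) := by
  induction p using Polynomial.induction_on' with
  | add p q hp hq =>
    simpa [add_sub_add_comm] using add_mem hp hq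
  | monomial n r =>
    induction n generalizing r with
    | zero => simp
    | succ n ih =>
      have h := add_mem (Submodule.smul_mem _ (monomial n r)
        (Submodule.mem_span_singleton_self (X - C a))) (ih (r * a))
      convert h using 1
      simp [mul_sub, monomial_mul_X, monomial_mul_C, pow_succ', mul_assoc]

theorem Polynomial.mem_span_X_sub_C_iff_eval_eq_zero {R : Type*} [Ring R] (a : R) (p : R[X]) :
    p ∈ (Submodule.span R[X] {X - C a} : Submodule R[X] R[X]) ↔ p.eval a = 0 := by
  refine ⟨fun h => ?_, fun h => ?_⟩
  · obtain ⟨q, rfl⟩ := Submodule.mem_span_singleton.1 h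
    exact eval_mul_X_sub_C a
  · simpa [h] using C_eval_sub_mem_span_X_sub_C a p

/-- Right multiplication by a unit, as an automorphism of the ring as a left module. -/
def Units.mulRightLinearEquivSelf {R : Type*} [Ring R] (u : Rˣ) : R ≃ₗ[R] R :=
  LinearEquiv.ofLinearMap (LinearMap.toSpanSingleton R R u) (LinearMap.toSpanSingleton R R ↑u⁻¹)
    (by ext; simp) (by ext; simp)

theorem stmt_6 {K : Type*} [DivisionRing K] (a b : K) :
    Nonempty ((K[X] ⧸ (Submodule.span K[X] {X - C a} : Submodule K[X] K[X])) ≃ₗ[K[X]]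
        (K[X] ⧸ (Submodule.span K[X] {X - C b} : Submodule K[X] K[X]))) ↔
      ∃ c : Kˣ, b = c * a * (c : K)⁻¹ := by
  constructor
  · rintro ⟨f⟩
    obtain ⟨q, hq⟩ := Submodule.Quotient.mk_surjective _ (f (Submodule.Quotient.mk 1))
    set c := q.eval b
    have hc : f (Submodule.Quotient.mk 1) = Submodule.Quotient.mk (C c) := by
      rw [← hq, Submodule.Quotient.eq]
      exact C_eval_sub_mem_span_X_sub_C b q
    have hmul (p : K[X]) : p.eval a = 0 ↔ (p * C c).eval b = 0 := by
      rw [← mem_span_X_sub_C_iff_eval_eq_zero, ← mem_span_X_sub_C_iff_eval_eq_zero,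
        ← Submodule.Quotient.mk_eq_zero, ← Submodule.Quotient.mk_eq_zero, ← smul_eq_mul,
        Submodule.Quotient.mk_smul, ← hc, ← map_smul, ← Submodule.Quotient.mk_smul,
        LinearEquiv.map_eq_zero_iff, smul_eq_mul, mul_one]
    have hc0 : c ≠ 0 := by simpa using hmul 1
    have hcomm : c * b = a * c := by
      have h := (hmul (X - C a)).1 (by simp)
      rwa [sub_mul, X_mul, eval_sub, eval_mul_X, eval_C_mul, eval_C, sub_eq_zero] at h
    refine ⟨(Units.mk0 c hc0)⁻¹, ?_⟩
    simp [mul_assoc, ← hcomm, hc0]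
  · rintro ⟨c, rfl⟩
    have hspan : (Submodule.span K[X] {X - C a}).map
        (c⁻¹.map (C : K →+* K[X]).toMonoidHom).mulRightLinearEquivSelf.toLinearMap =
        Submodule.span K[X] {X - C (c * a * (c : K)⁻¹)} := by
      rw [Submodule.map_span, Set.image_singleton,
        ← Submodule.span_singleton_smul_eq (c⁻¹.map (C : K →+* K[X]).toMonoidHom).isUnit
          (X - C (c * a * (c : K)⁻¹))]
      congr 2
      simp [Units.mulRightLinearEquivSelf, sub_mul, mul_sub, X_mul]
      simp [← mul_assoc, -map_mul, ← C_mul]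
    exact ⟨Submodule.Quotient.equiv _ _ _ hspan⟩
end

section
/- Let $K$ be a division ring and $f \in K[t]$ a monic polynomial of degree $n$. The following are equivalent: (i) the companion matrix $C_f$ is triangularizable over $K$ (similar to an upper triangular matrix); (ii) there exists a strictly increasing chain $0 = V_0 \subsetneq V_1 \subsetneq \cdots \subsetneq V_n = K[t]/K[t]f$ of left $K[t]$-submodules; (iii) $f$ is a product of monic linear polynomials $(t - a_1)\cdots(t - a_n)$ in $K[t]$. -/
open Polynomial

/-- The companion matrix of a (monic, degree `n`) polynomial `f`. -/
def companionMatrix {K : Type*} [DivisionRing K] (n : ℕ) (f : K[X]) :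
    Matrix (Fin n) (Fin n) K := fun i j =>
  if (i : ℕ) + 1 = (j : ℕ) then 1
  else if (i : ℕ) = n - 1 then -f.coeff (j : ℕ)
  else 0

open Matrix

/-- The product `(X - b (n - 1)) ⋯ (X - b 0)`, with new linear factors multiplied on the left. -/
noncomputable def linearProd {K : Type*} [DivisionRing K] (b : ℕ → K) : ℕ → K[X]
  | 0 => 1
  | n + 1 => (X - C (b n)) * linearProd b n

section linearProd

variable {K : Type*} [DivisionRing K]

theorem linearProd_monic (b : ℕ → K) (n : ℕ) : (linearProd b n).Monic := by
  induction n with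
  | zero => exact monic_one
  | succ n ih => exact (monic_X_sub_C _).mul ih

theorem natDegree_linearProd (b : ℕ → K) (n : ℕ) : (linearProd b n).natDegree = n := by
  induction n with
  | zero => exact natDegree_one
  | succ n ih =>
    rw [linearProd, (monic_X_sub_C _).natDegree_mul (linearProd_monic b n), ih, natDegree_X_sub_C,
      add_comm]

theorem linearProd_congr {b c : ℕ → K} {n : ℕ} (h : ∀ i < n, b i = c i) :
    linearProd b n = linearProd c n := by
  induction n with
  | zero => rfl
  | succ n ih =>
    rw [linearProd, linearProd, h n n.lt_succ_self, ih fun i hi => h i (hi.trans n.lt_succ_self)]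

theorem linearProd_eq_prod_ofFn (b : ℕ → K) (n : ℕ) :
    linearProd b n = (List.ofFn fun i : Fin n => X - C (b (n - 1 - i))).prod := by
  induction n with
  | zero => simp [linearProd]
  | succ n ih =>
    rw [linearProd, ih, List.ofFn_succ, List.prod_cons]
    congr 4
    funext i
    congr 3
    simp only [Fin.val_succ]
    omega

theorem exists_eq_prod_ofFn_iff {n : ℕ} {f : K[X]} :
    (∃ a : Fin n → K, f = (List.ofFn fun i : Fin n => X - C (a i)).prod) ↔
      ∃ b : ℕ → K, f = linearProd b n := by
  constructor
  · rintro ⟨a, rfl⟩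
    refine ⟨fun j => if h : n - 1 - j < n then a ⟨n - 1 - j, h⟩ else 0, ?_⟩
    rw [linearProd_eq_prod_ofFn]
    congr 2
    funext i
    have h : n - 1 - (n - 1 - (i : ℕ)) = i := by omega
    simp [h]
  · rintro ⟨b, rfl⟩
    exact ⟨fun i => b (n - 1 - i), linearProd_eq_prod_ofFn b n⟩

end linearProd

section LeftIdeals

variable {K : Type*} [DivisionRing K]

theorem exists_monic_generator (I : Submodule K[X] K[X]) {f : K[X]} (hf : f ≠ 0) (hfI : f ∈ I) :
    ∃ g ∈ I, g.Monic ∧ ∀ p ∈ I, ∃ q, p = q * g := by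
  classical
  have hex : ∃ d, ∃ g ∈ I, g ≠ 0 ∧ g.natDegree = d := ⟨_, f, hfI, hf, rfl⟩
  obtain ⟨g₀, hg₀I, hg₀, hdeg⟩ := Nat.find_spec hex
  have hmin : ∀ p ∈ I, p ≠ 0 → g₀.natDegree ≤ p.natDegree := fun p hp hp0 =>
    hdeg ▸ Nat.find_min' hex ⟨p, hp, hp0, rfl⟩
  have hc : g₀.leadingCoeff ≠ 0 := leadingCoeff_ne_zero.mpr hg₀
  have hgm : (C g₀.leadingCoeff⁻¹ * g₀).Monic := by
    simp [Monic, leadingCoeff_mul, hc]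
  have hgd : (C g₀.leadingCoeff⁻¹ * g₀).natDegree = g₀.natDegree :=
    natDegree_C_mul (inv_ne_zero hc)
  generalize hg : C g₀.leadingCoeff⁻¹ * g₀ = g at hgm hgd
  have hgI : g ∈ I := hg ▸ I.smul_mem _ hg₀I
  refine ⟨g, hgI, hgm, fun p => ?_⟩
  induction hd : p.degree using WellFoundedLT.induction generalizing p with
  | ind d ih =>
    intro hp
    by_cases hp0 : p = 0
    · exact ⟨0, by simp [hp0]⟩
    have hle : g.natDegree ≤ p.natDegree := hgd ▸ hmin p hp hp0
    set s : K[X] := C p.leadingCoeff * X ^ (p.natDegree - g.natDegree)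
    have hs : s ≠ 0 := by simp [s, hp0]
    have hsd : s.natDegree = p.natDegree - g.natDegree :=
      natDegree_C_mul_X_pow _ _ (leadingCoeff_ne_zero.mpr hp0)
    have hsl : s.leadingCoeff = p.leadingCoeff := by simp [s]
    have hlt : (p - s * g).degree < p.degree := by
      apply degree_sub_lt_left _ hp0
      · rw [leadingCoeff_mul, hgm.leadingCoeff, mul_one, hsl]
      · rw [degree_eq_natDegree hp0, degree_eq_natDegree (mul_ne_zero hs hgm.ne_zero),
          natDegree_mul hs hgm.ne_zero, hsd, Nat.sub_add_cancel hle]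
    obtain ⟨q, hq⟩ := ih _ (hd ▸ hlt) (p - s * g) rfl (I.sub_mem hp (I.smul_mem s hgI))
    exact ⟨q + s, by rw [add_mul, ← hq, sub_add_cancel]⟩

theorem exists_linearProd_of_strictMono {n : ℕ} {f : K[X]} (hf : f.Monic)
    (hdeg : f.natDegree ≤ n) (J : Fin (n + 1) → Submodule K[X] K[X]) (hJ : StrictMono J)
    (hmem : f ∈ J 0) :
    ∃ b : ℕ → K, f = linearProd b n := by
  induction n generalizing f with
  | zero => exact ⟨0, hf.natDegree_eq_zero.mp (Nat.le_zero.mp hdeg)⟩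
  | succ n ih =>
    have hlt : J 0 < J 1 := hJ (by simp)
    obtain ⟨g, hgJ, hgm, hg⟩ := exists_monic_generator (J 1) hf.ne_zero (hlt.le hmem)
    obtain ⟨h, hh⟩ := hg f (hlt.le hmem)
    have hhm : h.Monic := hgm.of_mul_monic_right (hh ▸ hf)
    have hd : f.natDegree = h.natDegree + g.natDegree := by rw [hh, hhm.natDegree_mul hgm]
    have hpos : h.natDegree ≠ 0 := by
      intro h0
      rw [hhm.natDegree_eq_zero.mp h0, one_mul] at hh
      refine hlt.not_ge fun p hp => ?_
      obtain ⟨q, rfl⟩ := hg p hp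
      exact (J 0).smul_mem q (hh ▸ hmem)
    obtain ⟨b, hb⟩ := ih hgm (by omega) (J ∘ Fin.succ) (hJ.comp Fin.strictMono_succ) hgJ
    have hgd : g.natDegree = n := hb ▸ natDegree_linearProd b n
    have hh1 : h.natDegree = 1 := by omega
    have hhX : h = X - C (-h.coeff 0) := by
      conv_lhs => rw [hhm.eq_X_add_C hh1]
      simp
    refine ⟨Function.update b n (-h.coeff 0), ?_⟩
    rw [linearProd, Function.update_self, ← hhX, hh, hb]
    congr 1
    exact linearProd_congr fun i hi => by rw [Function.update_of_ne hi.ne]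

theorem span_linearProd_strictAnti (b : ℕ → K) :
    StrictAnti fun n => Submodule.span K[X] {linearProd b n} := by
  refine strictAnti_nat_of_succ_lt fun n => lt_of_le_of_ne ?_ fun h => ?_
  · rw [Submodule.span_singleton_le_iff_mem]
    exact Submodule.mem_span_singleton.mpr ⟨X - C (b n), rfl⟩
  · have hmem : linearProd b n ∈ Submodule.span K[X] {linearProd b (n + 1)} :=
      h ▸ Submodule.mem_span_singleton_self _
    obtain ⟨q, hq⟩ := Submodule.mem_span_singleton.mp hmem
    have hq0 : q ≠ 0 := by
      rintro rfl
      exact (linearProd_monic b n).ne_zero (by simpa using hq.symm)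
    have := congrArg natDegree hq
    rw [smul_eq_mul, natDegree_mul hq0 (linearProd_monic b _).ne_zero, natDegree_linearProd,
      natDegree_linearProd] at this
    omega

theorem exists_chain_iff {n : ℕ} {f : K[X]} (hf : f.Monic) (hdeg : f.natDegree = n) :
    (∃ V : Fin (n + 1) → Submodule K[X]
          (K[X] ⧸ (Submodule.span K[X] {f} : Submodule K[X] K[X])),
        V 0 = ⊥ ∧ V (Fin.last n) = ⊤ ∧ StrictMono V) ↔ ∃ b : ℕ → K, f = linearProd b n := by
  constructor
  · rintro ⟨V, h0, -, hV⟩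
    have hker : (V 0).comap (Submodule.span K[X] {f}).mkQ = Submodule.span K[X] {f} := by
      rw [h0, Submodule.comap_bot, Submodule.ker_mkQ]
    refine exists_linearProd_of_strictMono hf hdeg.le
      (fun k => (V k).comap (Submodule.span K[X] {f}).mkQ)
      ((Submodule.comap_strictMono_of_surjective (Submodule.mkQ_surjective _)).comp hV) ?_
    rw [hker]
    exact Submodule.mem_span_singleton_self f
  · rintro ⟨b, rfl⟩
    set N := Submodule.span K[X] {linearProd b n} with hN
    set I : Fin (n + 1) → Submodule K[X] K[X] :=
      fun k => Submodule.span K[X] {linearProd b (n - k)} with hI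
    have hImono : StrictMono I := fun i j hij =>
      span_linearProd_strictAnti b (by have := j.2; simp only [Fin.lt_def] at hij; omega)
    have hI0 : I 0 = N := by simp [hI, hN]
    refine ⟨fun k => (I k).map N.mkQ, ?_, ?_, fun i j hij => ?_⟩
    · simp [hI0]
    · have : I (Fin.last n) = ⊤ := by
        simp only [hI, Fin.val_last, Nat.sub_self, linearProd]
        exact Ideal.span_singleton_one
      simp [this]
    · have key : ∀ k, ((I k).map N.mkQ).comap N.mkQ = I k := fun k => by
        rw [Submodule.comap_map_mkQ, sup_eq_right, ← hI0]
        exact hImono.monotone (Fin.zero_le k)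
      refine lt_of_le_of_ne (Submodule.map_mono (hImono hij).le) fun h => ?_
      exact (hImono hij).ne (by rw [← key i, ← key j]; exact congrArg _ h)

end LeftIdeals

section Companion

variable {K : Type*} [DivisionRing K]

theorem isUnit_of_lower_unitriangular {n : ℕ} {P : Matrix (Fin n) (Fin n) K}
    (hdiag : ∀ i, P i i = 1) (hupper : ∀ i j, i < j → P i j = 0) : IsUnit P := by
  have hinj : Function.Injective P.vecMulLinear := by
    rw [← LinearMap.ker_eq_bot, LinearMap.ker_eq_bot']
    intro v hv
    funext i
    induction i using WellFoundedGT.induction with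
    | ind i ih =>
      have h := congrFun hv i
      rw [vecMulLinear_apply, vecMul, dotProduct, Finset.sum_eq_single i, hdiag, mul_one] at h
      · exact h
      · intro k _ hk
        rcases lt_or_gt_of_ne hk with hlt | hgt
        · rw [hupper k i hlt, mul_zero]
        · rw [ih k hgt, Pi.zero_apply, zero_mul]
      · simp
  have hsurj := LinearMap.surjective_of_injective hinj
  obtain ⟨B, hB⟩ := vecMul_surjective_iff_exists_left_inverse.mp hsurj
  exact isUnit_iff_exists.mpr ⟨B, mul_eq_one_comm.mp hB, hB⟩

/-- Multiplication by the companion matrix of `f` is multiplication by `X` modulo `f`. -/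
theorem coeff_vecMul_companionMatrix {n : ℕ} (f q : K[X]) (hq : q.natDegree < n) (j : Fin n) :
    ((fun k : Fin n => q.coeff k) ᵥ* companionMatrix n f) j =
      (X * q - C (q.coeff (n - 1)) * f).coeff j := by
  obtain ⟨m, rfl⟩ : ∃ m, n = m + 1 := ⟨n - 1, by omega⟩
  rw [vecMul, dotProduct, Fin.sum_univ_castSucc, coeff_sub, coeff_C_mul]
  have hlast : companionMatrix (m + 1) f (Fin.last m) j = -f.coeff j := by
    have := j.2
    simp only [companionMatrix, Fin.val_last]
    rw [if_neg (by omega), if_pos (by omega)]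
  have hinit : ∀ i : Fin m, companionMatrix (m + 1) f i.castSucc j =
      if (i : ℕ) + 1 = j then 1 else 0 := fun i => by
    have := i.2
    simp only [companionMatrix, Fin.val_castSucc]
    congr 1
    rw [if_neg (by omega)]
  simp only [hlast, hinit, Fin.val_last, Fin.val_castSucc, Nat.add_sub_cancel, mul_neg,
    ← sub_eq_add_neg]
  congr 1
  cases j using Fin.cases with
  | zero => simp
  | succ j =>
    rw [Finset.sum_eq_single j]
    · simp
    · intro k _ hk
      simp [Fin.val_inj, hk]
    · simp

theorem triangularizable_of_linearProd (n : ℕ) (b : ℕ → K) :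
    ∃ P : (Matrix (Fin n) (Fin n) K)ˣ, ∀ i j : Fin n, (j : ℕ) < (i : ℕ) →
      (P.val * companionMatrix n (linearProd b n) * P.inv) i j = 0 := by
  let P : Matrix (Fin n) (Fin n) K := fun i j => (linearProd b i).coeff j
  have hcoeff : ∀ i, (linearProd b i).coeff i = 1 := fun i => by
    have := linearProd_monic b i
    rwa [Monic, leadingCoeff, natDegree_linearProd] at this
  have hzero : ∀ i j, i < j → (linearProd b i).coeff j = 0 := fun i j hij =>
    coeff_eq_zero_of_natDegree_lt (by rwa [natDegree_linearProd])
  obtain ⟨U, hU⟩ := isUnit_of_lower_unitriangular (P := P) (fun i => hcoeff i)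
    (fun i j hij => hzero i j hij)
  let T : Matrix (Fin n) (Fin n) K := fun i k =>
    if k = i then b i else if (k : ℕ) = i + 1 then 1 else 0
  have hX : ∀ i, X * linearProd b i = linearProd b (i + 1) + C (b i) * linearProd b i :=
    fun i => by rw [linearProd, sub_mul, sub_add_cancel]
  have hPT : P * companionMatrix n (linearProd b n) = T * P := by
    ext i j
    have hl := coeff_vecMul_companionMatrix (linearProd b n) (linearProd b i)
      (by rw [natDegree_linearProd]; exact i.2) j
    have hi := i.2
    trans (X * linearProd b i - C ((linearProd b i).coeff (n - 1)) * linearProd b n).coeff j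
    · exact hl
    rw [hX, mul_apply]
    by_cases hin : (i : ℕ) + 1 < n
    · rw [hzero i (n - 1) (by omega), C_0, zero_mul, sub_zero, coeff_add, coeff_C_mul]
      have hne : (⟨i + 1, hin⟩ : Fin n) ≠ i := by simp [Fin.ext_iff]
      rw [Finset.sum_eq_add_of_mem _ _ (Finset.mem_univ _) (Finset.mem_univ _) hne]
      · simp [T, P, hne]
      · intro k _ hk
        have : (k : ℕ) ≠ i + 1 := fun h => hk.1 (Fin.ext h)
        simp [T, hk.2, this]
    · have hin' : (i : ℕ) + 1 = n := by omega
      have hi' : n - 1 = i := by omega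
      rw [hi', hcoeff, hin', C_1, one_mul, add_sub_cancel_left, coeff_C_mul,
        Finset.sum_eq_single i]
      · simp [T, P]
      · intro k _ hk
        have := k.2
        have : (k : ℕ) ≠ i + 1 := by omega
        simp [T, hk, this]
      · simp
  refine ⟨U, fun i j hij => ?_⟩
  have : U.val * companionMatrix n (linearProd b n) * U.inv = T := by
    rw [hU, hPT, ← hU, mul_assoc, U.val_inv, mul_one]
  rw [this]
  have h1 : j ≠ i := fun h => by simp [h] at hij
  have h2 : (j : ℕ) ≠ i + 1 := by omega
  simp [T, h1, h2]

/-- Evaluation of polynomials at the companion matrix, applied to the first basis vector. -/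
noncomputable def companionEval (m : ℕ) (f : K[X]) : K[X] →ₗ[K] (Fin (m + 1) → K) :=
  lsum fun i => LinearMap.toSpanSingleton K _ (Pi.single 0 1 ᵥ* companionMatrix (m + 1) f ^ i)

theorem companionEval_monomial (m : ℕ) (f : K[X]) (i : ℕ) (c : K) :
    companionEval m f (monomial i c) =
      c • (Pi.single 0 1 ᵥ* companionMatrix (m + 1) f ^ i) := by
  simp [companionEval, lsum_apply, sum_monomial_index]

theorem companionEval_X_mul (m : ℕ) (f g : K[X]) :
    companionEval m f (X * g) = companionEval m f g ᵥ* companionMatrix (m + 1) f := by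
  induction g using Polynomial.induction_on' with
  | add p q hp hq => rw [mul_add, map_add, hp, hq, map_add, add_vecMul]
  | monomial i c =>
    rw [X_mul_monomial, companionEval_monomial, companionEval_monomial, smul_vecMul, vecMul_vecMul,
      pow_succ]

theorem companionEval_of_natDegree_lt (m : ℕ) (f : K[X]) {g : K[X]} (hg : g.natDegree < m + 1) :
    companionEval m f g = fun j : Fin (m + 1) => g.coeff j := by
  have hpow : ∀ i (hi : i < m + 1), Pi.single 0 1 ᵥ* companionMatrix (m + 1) f ^ i =
      fun j : Fin (m + 1) => (X ^ i : K[X]).coeff j := by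
    intro i
    induction i with
    | zero =>
      intro _
      funext j
      rw [pow_zero, vecMul_one, pow_zero, coeff_one, Pi.single_apply]
      simp only [Fin.ext_iff, Fin.val_zero]
    | succ i ih =>
      intro hi
      rw [pow_succ, ← vecMul_vecMul, ih (by omega)]
      funext j
      rw [coeff_vecMul_companionMatrix _ _ (by rw [natDegree_X_pow]; omega), coeff_X_pow,
        if_neg (by omega), C_0, zero_mul, sub_zero, ← pow_succ']
  conv_lhs => rw [g.as_sum_range' (m + 1) hg]
  rw [map_sum]
  funext j
  rw [Finset.sum_apply, Finset.sum_eq_single (j : ℕ)]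
  · simp [companionEval_monomial, hpow j j.2]
  · intro i hi hij
    simp [companionEval_monomial, hpow i (Finset.mem_range.mp hi), coeff_X_pow, hij.symm]
  · exact fun h => absurd (Finset.mem_range.mpr j.2) h

theorem companionEval_self (m : ℕ) {f : K[X]} (hf : f.Monic) (hdeg : f.natDegree = m + 1) :
    companionEval m f f = 0 := by
  have hlt : (f - X ^ (m + 1)).natDegree < m + 1 := by
    by_cases h0 : f - X ^ (m + 1) = 0
    · simp [h0]
    have hd : f.degree = m + 1 := by
      rw [degree_eq_natDegree hf.ne_zero, hdeg]
      rfl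
    have := degree_sub_lt_left (q := X ^ (m + 1)) (by rw [hd, degree_X_pow]; rfl) hf.ne_zero
      (by rw [hf.leadingCoeff, leadingCoeff_X_pow])
    rw [natDegree_lt_iff_degree_lt h0]
    exact this.trans_eq hd
  have hsplit : f = (f - X ^ (m + 1)) + X * X ^ m := by rw [← pow_succ', sub_add_cancel]
  rw [show companionEval m f f = companionEval m f ((f - X ^ (m + 1)) + X * X ^ m) from
    congrArg _ hsplit, map_add, companionEval_X_mul, companionEval_of_natDegree_lt m f hlt,
    companionEval_of_natDegree_lt m f (by rw [natDegree_X_pow]; omega)]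
  funext j
  rw [Pi.add_apply, coeff_vecMul_companionMatrix _ _ (by rw [natDegree_X_pow]; omega),
    ← pow_succ']
  simp

/-- The left ideal of polynomials whose evaluation at `companionMatrix (m + 1) f` has its first
`m + 1 - k` coordinates equal to zero after multiplication by `Q`. -/
noncomputable def flagIdeal (m : ℕ) (f : K[X]) (Q T : Matrix (Fin (m + 1)) (Fin (m + 1)) K)
    (hT : ∀ i j, j < i → T i j = 0) (hQT : companionMatrix (m + 1) f * Q = Q * T) (k : ℕ) :
    Submodule K[X] K[X] where
  carrier := {g | ∀ j : Fin (m + 1), (j : ℕ) + k < m + 1 → (companionEval m f g ᵥ* Q) j = 0}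
  zero_mem' j _ := by simp
  add_mem' {p q} hp hq j hj := by rw [map_add, add_vecMul, Pi.add_apply, hp j hj, hq j hj, add_zero]
  smul_mem' p q hq := by
    have hX : ∀ i : ℕ, ∀ j : Fin (m + 1), (j : ℕ) + k < m + 1 →
        (companionEval m f (X ^ i * q) ᵥ* Q) j = 0 := by
      intro i
      induction i with
      | zero => simpa using hq
      | succ i ih =>
        intro j hj
        rw [pow_succ', mul_assoc, companionEval_X_mul, vecMul_vecMul, hQT, ← vecMul_vecMul, vecMul,
          dotProduct]
        refine Finset.sum_eq_zero fun l _ => ?_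
        by_cases hlj : j < l
        · rw [hT l j hlj, mul_zero]
        · rw [ih l (by simp only [Fin.lt_def] at hlj; omega), zero_mul]
    intro j hj
    induction p using Polynomial.induction_on' with
    | add p p' hp hp' => rw [add_smul, map_add, add_vecMul, Pi.add_apply, hp, hp', add_zero]
    | monomial i c =>
      rw [smul_eq_mul, ← C_mul_X_pow_eq_monomial, mul_assoc, ← smul_eq_C_mul, map_smul, smul_vecMul,
        Pi.smul_apply, hX i j hj, smul_zero]

theorem exists_linearProd_of_triangularizable {n : ℕ} {f : K[X]} (hf : f.Monic)
    (hdeg : f.natDegree = n) (P : (Matrix (Fin n) (Fin n) K)ˣ)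
    (hP : ∀ i j : Fin n, (j : ℕ) < (i : ℕ) → (P.val * companionMatrix n f * P.inv) i j = 0) :
    ∃ b : ℕ → K, f = linearProd b n := by
  cases n with
  | zero => exact ⟨0, hf.natDegree_eq_zero.mp hdeg⟩
  | succ m =>
  have hQT : companionMatrix (m + 1) f * P.inv =
      P.inv * (P.val * companionMatrix (m + 1) f * P.inv) := by
    rw [← mul_assoc, ← mul_assoc, P.inv_val, one_mul]
  let J := flagIdeal m f P.inv _ hP hQT
  refine exists_linearProd_of_strictMono hf hdeg.le (fun k => J k)
    (Fin.strictMono_iff_lt_succ.mpr fun k => ?_) fun j _ => by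
      rw [companionEval_self m hf hdeg, zero_vecMul, Pi.zero_apply]
  rw [SetLike.lt_iff_le_and_exists]
  refine ⟨fun g hg j hj => hg j (by simp only [Fin.val_succ, Fin.val_castSucc] at hj ⊢; omega), ?_⟩
  let g : K[X] := ∑ i : Fin (m + 1), monomial i (P.val k.rev i)
  have hcoeff : ∀ j : Fin (m + 1), g.coeff j = P.val k.rev j := fun j => by
    simp [g, coeff_monomial, Fin.val_inj]
  have hgd : g.natDegree < m + 1 := Nat.lt_succ_of_le <| natDegree_sum_le_of_forall_le _ _
    fun i _ => (natDegree_monomial_le _).trans (Nat.le_of_lt_succ i.2)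
  have heval : companionEval m f g ᵥ* P.inv = (1 : Matrix (Fin (m + 1)) (Fin (m + 1)) K) k.rev := by
    rw [companionEval_of_natDegree_lt m f hgd, ← P.val_inv, funext hcoeff]
    rfl
  refine ⟨g, fun j hj => ?_, fun hg => ?_⟩
  · rw [heval, one_apply_ne]
    rintro rfl
    simp only [Fin.val_rev, Fin.val_succ] at hj
    omega
  · have h := hg k.rev (by simp only [Fin.val_rev, Fin.val_castSucc]; omega)
    rw [heval, one_apply_eq] at h
    exact one_ne_zero h

end Companion

theorem stmt_12 {K : Type*} [DivisionRing K] {n : ℕ} (f : K[X])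
    (hf : f.Monic) (hdeg : f.natDegree = n) :
    ((∃ P : (Matrix (Fin n) (Fin n) K)ˣ,
        ∀ i j : Fin n, (j : ℕ) < (i : ℕ) → (P.val * companionMatrix n f * P.inv) i j = 0) ↔
      (∃ a : Fin n → K, f = (List.ofFn fun i : Fin n => X - C (a i)).prod)) ∧
    ((∃ V : Fin (n + 1) → Submodule K[X]
          (K[X] ⧸ (Submodule.span K[X] {f} : Submodule K[X] K[X])),
        V 0 = ⊥ ∧ V (Fin.last n) = ⊤ ∧ StrictMono V) ↔
      (∃ a : Fin n → K, f = (List.ofFn fun i : Fin n => X - C (a i)).prod)) := by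
  rw [exists_eq_prod_ofFn_iff]
  refine ⟨⟨fun ⟨P, hP⟩ => exists_linearProd_of_triangularizable hf hdeg P hP, ?_⟩,
    exists_chain_iff hf hdeg⟩
  rintro ⟨b, rfl⟩
  exact triangularizable_of_linearProd n b
end
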